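/- Let 𝕋 ⊆ ℂ be the unit circle, let A = {f ∈ C(𝕋 × [0,1], M₂(ℂ)) : for every z ∈ 𝕋 and t ∈ {0,1} there exist a, b ∈ ℂ with f(z,t) = [[a, z·b],[b, a]]}, and fix α ∈ 𝕋. Define π₁, π₂ : A → ℂ by π₁(f) = a + α·b and π₂(f) = a − α·b, where a = f(α²,1)₁₁ and b = f(α²,1)₂₁. Then π₁ and π₂ are distinct unital *-algebra homomorphisms from A onto ℂ, their kernels ker π₁ and ker π₂ are distinct maximal two-sided ideals of A, and ker π₁ ∩ Z(A) = ker π₂ ∩ Z(A) = {f ∈ Z(A) : f(α²,1) = 0}. -/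

import Mathlib

/- Basic notions about (closed) two-sided ideals of a topological ring,
   weak centrality, and closed ideals generated by a set. -/

section Defs
variable {R : Type*}

/-- A two-sided ring ideal, as a subset of `R`. -/
def IsIdealSet [NonUnitalNonAssocRing R] (S : Set R) : Prop :=
  (0 : R) ∈ S ∧ (∀ x ∈ S, ∀ y ∈ S, x + y ∈ S) ∧ (∀ x ∈ S, -x ∈ S) ∧
    ∀ x ∈ S, ∀ a : R, a * x ∈ S ∧ x * a ∈ S

/-- A closed two-sided ideal of a topological ring. -/
def IsClosedIdealSet [NonUnitalNonAssocRing R] [TopologicalSpace R] (S : Set R) : Prop :=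
  IsIdealSet S ∧ IsClosed S

/-- A maximal (proper) closed two-sided ideal of a topological ring. -/
def IsMaxClosedIdealSet [NonUnitalNonAssocRing R] [TopologicalSpace R] (S : Set R) : Prop :=
  IsClosedIdealSet S ∧ S ≠ Set.univ ∧
    ∀ T : Set R, IsClosedIdealSet T → S ⊆ T → T = S ∨ T = Set.univ

/-- A maximal (proper) two-sided ideal (no closedness requirement). -/
def IsMaxIdealSet [NonUnitalNonAssocRing R] (S : Set R) : Prop :=
  IsIdealSet S ∧ S ≠ Set.univ ∧
    ∀ T : Set R, IsIdealSet T → S ⊆ T → T = S ∨ T = Set.univ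

/-- The center of `R`, as a set. -/
def centerSet (R : Type*) [Mul R] : Set R := {z : R | ∀ a : R, z * a = a * z}

/-- A topological ring is weakly central if no maximal closed two-sided ideal contains the
center, and the map `M ↦ M ∩ Z(R)` is injective on maximal closed two-sided ideals. -/
def WeaklyCentral (R : Type*) [NonUnitalNonAssocRing R] [TopologicalSpace R] : Prop :=
  (∀ M : Set R, IsMaxClosedIdealSet M → ¬ centerSet R ⊆ M) ∧
    ∀ M N : Set R, IsMaxClosedIdealSet M → IsMaxClosedIdealSet N →
      M ∩ centerSet R = N ∩ centerSet R → M = N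

/-- The closed two-sided ideal generated by a set `S`. -/
def closedIdealGen [NonUnitalNonAssocRing R] [TopologicalSpace R] (S : Set R) : Set R :=
  ⋂₀ {T : Set R | IsClosedIdealSet T ∧ S ⊆ T}

end Defs

section RelativeDefs
variable {R : Type*}

/-- A closed two-sided ideal of the subalgebra `𝒜 ⊆ R`, as a subset of `R`. -/
def IsClosedIdealIn [NonUnitalNonAssocRing R] [TopologicalSpace R] (𝒜 M : Set R) : Prop :=
  M ⊆ 𝒜 ∧ (0 : R) ∈ M ∧ (∀ x ∈ M, ∀ y ∈ M, x + y ∈ M) ∧ (∀ x ∈ M, -x ∈ M) ∧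
    (∀ x ∈ M, ∀ a ∈ 𝒜, a * x ∈ M ∧ x * a ∈ M) ∧ IsClosed M

/-- A maximal (proper) closed two-sided ideal of the subalgebra `𝒜 ⊆ R`. -/
def IsMaxClosedIdealIn [NonUnitalNonAssocRing R] [TopologicalSpace R] (𝒜 M : Set R) : Prop :=
  IsClosedIdealIn 𝒜 M ∧ M ≠ 𝒜 ∧
    ∀ T : Set R, IsClosedIdealIn 𝒜 T → M ⊆ T → T = M ∨ T = 𝒜

/-- A two-sided ideal of the subalgebra `𝒜 ⊆ R` (no closedness). -/
def IsIdealIn [NonUnitalNonAssocRing R] (𝒜 M : Set R) : Prop :=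
  M ⊆ 𝒜 ∧ (0 : R) ∈ M ∧ (∀ x ∈ M, ∀ y ∈ M, x + y ∈ M) ∧ (∀ x ∈ M, -x ∈ M) ∧
    ∀ x ∈ M, ∀ a ∈ 𝒜, a * x ∈ M ∧ x * a ∈ M

/-- A maximal (proper) two-sided ideal of the subalgebra `𝒜 ⊆ R`. -/
def IsMaxIdealIn [NonUnitalNonAssocRing R] (𝒜 M : Set R) : Prop :=
  IsIdealIn 𝒜 M ∧ M ≠ 𝒜 ∧ ∀ T : Set R, IsIdealIn 𝒜 T → M ⊆ T → T = M ∨ T = 𝒜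

/-- The center of the subalgebra `𝒜 ⊆ R`, as a subset of `R`. -/
def centerIn [Mul R] (𝒜 : Set R) : Set R := {z ∈ 𝒜 | ∀ a ∈ 𝒜, z * a = a * z}

/-- Weak centrality of the subalgebra `𝒜 ⊆ R`: no maximal closed two-sided ideal of `𝒜`
contains the center of `𝒜`, and `M ↦ M ∩ Z(𝒜)` is injective on maximal closed two-sided
ideals of `𝒜`. -/
def WeaklyCentralIn [NonUnitalNonAssocRing R] [TopologicalSpace R] (𝒜 : Set R) : Prop :=
  (∀ M : Set R, IsMaxClosedIdealIn 𝒜 M → ¬ centerIn 𝒜 ⊆ M) ∧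
    ∀ M N : Set R, IsMaxClosedIdealIn 𝒜 M → IsMaxClosedIdealIn 𝒜 N →
      M ∩ centerIn 𝒜 = N ∩ centerIn 𝒜 → M = N

end RelativeDefs

/-- The unit circle in `ℂ`. -/
abbrev UnitCircle : Type := {z : ℂ // ‖z‖ = 1}

/-- The cylinder `𝕋 × [0,1]`. -/
abbrev Cylinder : Type := UnitCircle × unitInterval

/-- The C*-algebra of the wallpaper group, realized inside `C(𝕋 × [0,1], M₂(ℂ))`:
continuous matrix-valued functions whose values at `(z, 0)` and `(z, 1)` have the form
`[[a, z·b], [b, a]]`. -/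
def WallpaperAlg : Set C(Cylinder, Matrix (Fin 2) (Fin 2) ℂ) :=
  {f | ∀ z : UnitCircle, ∀ t : unitInterval, (t = 0 ∨ t = 1) →
    ∃ a b : ℂ, f (z, t) = !![a, (z : ℂ) * b; b, a]}

/-- The point `(α², 1)` of the cylinder, for `α` on the unit circle. -/
def charPoint (α : ℂ) (hα : ‖α‖ = 1) : Cylinder :=
  (⟨α ^ 2, by rw [norm_pow, hα, one_pow]⟩, 1)

/-- The evaluation `f ↦ a + α·b` at the point `(α², 1)`, where
`f(α²,1) = [[a, α²·b],[b, a]]`, i.e. `a = f(α²,1)₁₁`, `b = f(α²,1)₂₁`. -/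
noncomputable def piPlus (α : ℂ) (hα : ‖α‖ = 1) (f : C(Cylinder, Matrix (Fin 2) (Fin 2) ℂ)) : ℂ :=
  f (charPoint α hα) 0 0 + α * f (charPoint α hα) 1 0

/-- The evaluation `f ↦ a - α·b` at the point `(α², 1)`. -/
noncomputable def piMinus (α : ℂ) (hα : ‖α‖ = 1) (f : C(Cylinder, Matrix (Fin 2) (Fin 2) ℂ)) : ℂ :=
  f (charPoint α hα) 0 0 - α * f (charPoint α hα) 1 0

/-- `π` is a unital *-algebra homomorphism from the subalgebra `𝒜` onto `ℂ`. -/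
def IsCharacterOn (𝒜 : Set C(Cylinder, Matrix (Fin 2) (Fin 2) ℂ))
    (π : C(Cylinder, Matrix (Fin 2) (Fin 2) ℂ) → ℂ) : Prop :=
  π 1 = 1 ∧
  (∀ f ∈ 𝒜, ∀ g ∈ 𝒜, π (f + g) = π f + π g) ∧
  (∀ f ∈ 𝒜, ∀ g ∈ 𝒜, π (f * g) = π f * π g) ∧
  (∀ (c : ℂ), ∀ f ∈ 𝒜, π (c • f) = c * π f) ∧
  (∀ f ∈ 𝒜, π (star f) = starRingEnd ℂ (π f)) ∧
  ∀ c : ℂ, ∃ f ∈ 𝒜, π f = c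

namespace WallpaperAlg

theorem one_mem : (1 : C(Cylinder, Matrix (Fin 2) (Fin 2) ℂ)) ∈ WallpaperAlg := by
  intro z t _
  refine ⟨1, 0, ?_⟩
  ext i j
  fin_cases i <;> fin_cases j <;> simp

theorem add_mem {f g : C(Cylinder, Matrix (Fin 2) (Fin 2) ℂ)} (hf : f ∈ WallpaperAlg)
    (hg : g ∈ WallpaperAlg) : f + g ∈ WallpaperAlg := by
  intro z t ht
  obtain ⟨a, b, h⟩ := hf z t ht
  obtain ⟨c, d, h'⟩ := hg z t ht
  refine ⟨a + c, b + d, ?_⟩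
  ext i j
  fin_cases i <;> fin_cases j <;> simp [h, h', mul_add]

theorem smul_mem (c : ℂ) {f : C(Cylinder, Matrix (Fin 2) (Fin 2) ℂ)} (hf : f ∈ WallpaperAlg) :
    c • f ∈ WallpaperAlg := by
  intro z t ht
  obtain ⟨a, b, h⟩ := hf z t ht
  refine ⟨c * a, c * b, ?_⟩
  ext i j
  fin_cases i <;> fin_cases j <;> simp [h, mul_left_comm]

theorem mul_mem {f g : C(Cylinder, Matrix (Fin 2) (Fin 2) ℂ)} (hf : f ∈ WallpaperAlg)
    (hg : g ∈ WallpaperAlg) : f * g ∈ WallpaperAlg := by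
  intro z t ht
  obtain ⟨a, b, h⟩ := hf z t ht
  obtain ⟨c, d, h'⟩ := hg z t ht
  refine ⟨a * c + z * b * d, b * c + a * d, ?_⟩
  ext i j
  fin_cases i <;> fin_cases j <;> simp [h, h', Matrix.mul_apply, Fin.sum_univ_two] <;> ring

/-- The unitary `(z, t) ↦ [[0, z], [1, 0]]`. -/
def swap : C(Cylinder, Matrix (Fin 2) (Fin 2) ℂ) where
  toFun p := !![0, (p.1 : ℂ); 1, 0]
  continuous_toFun := by
    refine continuous_matrix fun i j ↦ ?_
    fin_cases i <;> fin_cases j <;> simp <;> fun_prop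

theorem swap_mem : swap ∈ WallpaperAlg := fun z t _ ↦ ⟨0, 1, by simp [swap]⟩

/-- The function `(z, t) ↦ t (1 - t) E₁₁`, vanishing on the boundary of the cylinder. -/
def corner : C(Cylinder, Matrix (Fin 2) (Fin 2) ℂ) where
  toFun p := !![((p.2 : ℝ) : ℂ) * (1 - ((p.2 : ℝ) : ℂ)), 0; 0, 0]
  continuous_toFun := by
    refine continuous_matrix fun i j ↦ ?_
    fin_cases i <;> fin_cases j <;> simp <;> fun_prop

theorem corner_mem : corner ∈ WallpaperAlg := by
  rintro z t (rfl | rfl) <;> refine ⟨0, 0, ?_⟩ <;> simp [corner]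

theorem apply_one_zero_eq_zero_of_mem_center {f : C(Cylinder, Matrix (Fin 2) (Fin 2) ℂ)}
    (hf : f ∈ centerIn WallpaperAlg) (p : Cylinder) : f p 1 0 = 0 := by
  obtain ⟨z, t⟩ := p
  have hdense : Dense ({0, 1}ᶜ : Set unitInterval) := by
    simpa [Set.compl_eq_univ_sdiff] using
      dense_univ.sdiff_finite (Set.toFinite {(0 : unitInterval), 1})
  have hcont : Continuous fun s : unitInterval ↦ f (z, s) 1 0 :=
    ((f.continuous.comp (by fun_prop : Continuous fun s : unitInterval ↦ (z, s))).matrix_elem 1 0)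
  have heq := hcont.ext_on hdense continuous_const (g := fun _ ↦ (0 : ℂ)) fun s hs ↦ by
    have h := congrArg (fun g ↦ g (z, s) 1 0) (hf.2 corner corner_mem)
    simp [corner, Matrix.mul_apply, Fin.sum_univ_two, sub_eq_zero] at h
    simp only [Set.mem_compl_iff, Set.mem_insert_iff, Set.mem_singleton_iff, not_or] at hs
    rcases h with h | h | h
    · exact h
    · exact absurd h hs.1
    · exact absurd (Subtype.ext (by exact_mod_cast h.symm)) hs.2
  exact congrFun heq t

theorem exists_apply_charPoint {f : C(Cylinder, Matrix (Fin 2) (Fin 2) ℂ)}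
    (hf : f ∈ WallpaperAlg) (α : ℂ) (hα : ‖α‖ = 1) :
    ∃ a b : ℂ, f (charPoint α hα) = !![a, α ^ 2 * b; b, a] :=
  hf _ 1 (Or.inr rfl)

theorem isCharacterOn_piPlus (α : ℂ) (hα : ‖α‖ = 1) :
    IsCharacterOn WallpaperAlg (piPlus α hα) := by
  refine ⟨by simp [piPlus], fun f _ g _ ↦ ?_, fun f hf g hg ↦ ?_, fun c f _ ↦ ?_,
    fun f hf ↦ ?_, fun c ↦ ⟨c • 1, smul_mem c one_mem, by simp [piPlus]⟩⟩
  · simp only [piPlus, ContinuousMap.add_apply, Matrix.add_apply]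
    ring
  · obtain ⟨a, b, h⟩ := exists_apply_charPoint hf α hα
    obtain ⟨c, d, h'⟩ := exists_apply_charPoint hg α hα
    simp [piPlus, h, h', Matrix.mul_apply, Fin.sum_univ_two]
    ring
  · simp only [piPlus, ContinuousMap.smul_apply, Matrix.smul_apply, smul_eq_mul]
    ring
  · obtain ⟨a, b, h⟩ := exists_apply_charPoint hf α hα
    have hmul : α * starRingEnd ℂ α = 1 := by simp [Complex.mul_conj', hα]
    simp [piPlus, h, Matrix.star_apply]
    linear_combination (starRingEnd ℂ α) * (starRingEnd ℂ b) * hmul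

theorem charPoint_neg (α : ℂ) (hα : ‖α‖ = 1) :
    charPoint (-α) ((norm_neg α).trans hα) = charPoint α hα := by
  simp [charPoint]

theorem piMinus_eq_piPlus_neg (α : ℂ) (hα : ‖α‖ = 1) :
    piMinus α hα = piPlus (-α) ((norm_neg α).trans hα) := by
  ext f
  rw [piPlus, piMinus, charPoint_neg α hα]
  ring

theorem isMaxIdealIn_ker {π : C(Cylinder, Matrix (Fin 2) (Fin 2) ℂ) → ℂ}
    (hπ : IsCharacterOn WallpaperAlg π) :
    IsMaxIdealIn WallpaperAlg {f ∈ WallpaperAlg | π f = 0} := by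
  obtain ⟨hone, hadd, hmul, hsmul, -, -⟩ := hπ
  refine ⟨⟨fun f hf ↦ hf.1, ?_, ?_, ?_, ?_⟩, ?_, ?_⟩
  · rw [← zero_smul ℂ (1 : C(Cylinder, Matrix (Fin 2) (Fin 2) ℂ))]
    exact ⟨smul_mem 0 one_mem, by rw [hsmul _ _ one_mem, zero_mul]⟩
  · rintro f ⟨hf, hf0⟩ g ⟨hg, hg0⟩
    exact ⟨add_mem hf hg, by rw [hadd f hf g hg, hf0, hg0, add_zero]⟩
  · rintro f ⟨hf, hf0⟩
    rw [← neg_one_smul ℂ f]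
    exact ⟨smul_mem _ hf, by rw [hsmul _ _ hf, hf0, mul_zero]⟩
  · rintro f ⟨hf, hf0⟩ g hg
    exact ⟨⟨mul_mem hg hf, by rw [hmul g hg f hf, hf0, mul_zero]⟩,
      ⟨mul_mem hf hg, by rw [hmul f hf g hg, hf0, zero_mul]⟩⟩
  · intro h
    have h1 := h.symm ▸ one_mem
    exact one_ne_zero (hone.symm.trans h1.2)
  · rintro T ⟨hTA, -, hTadd, -, hTmul⟩ hT
    by_cases hle : ∀ f ∈ T, π f = 0
    · exact Or.inl (Set.Subset.antisymm (fun f hf ↦ ⟨hTA hf, hle f hf⟩) hT)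
    · right
      push Not at hle
      obtain ⟨f, hfT, hf0⟩ := hle
      refine Set.Subset.antisymm hTA fun g hg ↦ ?_
      have hc := smul_mem (π g * (π f)⁻¹) one_mem
      have hgf := (hTmul f hfT _ hc).1
      have hn := smul_mem (-1) (hTA hgf)
      have hd : g + (-1 : ℂ) • ((π g * (π f)⁻¹) • 1 * f) ∈ T := by
        refine hT ⟨add_mem hg hn, ?_⟩
        rw [hadd _ hg _ hn, hsmul _ _ (hTA hgf), hmul _ hc _ (hTA hfT), hsmul _ _ one_mem, hone]
        field_simp
        ring
      convert hTadd _ hd _ hgf using 1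
      ext p i j
      simp

theorem ker_piPlus_inter_center (α : ℂ) (hα : ‖α‖ = 1) :
    {f ∈ WallpaperAlg | piPlus α hα f = 0} ∩ centerIn WallpaperAlg =
      {f ∈ centerIn WallpaperAlg | f (charPoint α hα) = 0} := by
  ext f
  constructor
  · rintro ⟨⟨hf, hf0⟩, hfc⟩
    refine ⟨hfc, ?_⟩
    have hb := apply_one_zero_eq_zero_of_mem_center hfc (charPoint α hα)
    obtain ⟨a, b, h⟩ := exists_apply_charPoint hf α hα
    obtain rfl : b = 0 := by simpa [h] using hb
    obtain rfl : a = 0 := by simpa [piPlus, h] using hf0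
    rw [h]
    ext i j
    fin_cases i <;> fin_cases j <;> simp
  · rintro ⟨hfc, h⟩
    exact ⟨⟨hfc.1, by simp [piPlus, h]⟩, hfc⟩

theorem ker_piPlus_ne_ker_piMinus (α : ℂ) (hα : ‖α‖ = 1) :
    {f ∈ WallpaperAlg | piPlus α hα f = 0} ≠ {f ∈ WallpaperAlg | piMinus α hα f = 0} := by
  intro h
  have hα0 : α ≠ 0 := norm_ne_zero_iff.mp (by simp [hα])
  have hmem : swap + (-α) • 1 ∈ {f ∈ WallpaperAlg | piPlus α hα f = 0} :=
    ⟨add_mem swap_mem (smul_mem _ one_mem), by simp [piPlus, swap]⟩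
  rw [h] at hmem
  have h0 : -α - α = 0 := by simpa [piMinus, swap] using hmem.2
  exact hα0 (by linear_combination (-1 / 2) * h0)

end WallpaperAlg

/-- **Two distinct maximal ideals of the wallpaper-group C*-algebra with the same central
part.**  Fix `α` on the unit circle.  The maps `π₁ f = a + α·b` and `π₂ f = a - α·b`
(where `f(α²,1) = [[a, α²b],[b, a]]`) are distinct characters of the wallpaper algebra
`A`; their kernels are distinct maximal two-sided ideals of `A`, and both kernels meet the
center of `A` in `{f ∈ Z(A) : f(α²,1) = 0}`.  (Hence `A` is not weakly central.) -/
theorem wallpaperAlg_two_maximal_ideals_same_central_part (α : ℂ) (hα : ‖α‖ = 1) :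
    IsCharacterOn WallpaperAlg (piPlus α hα) ∧
    IsCharacterOn WallpaperAlg (piMinus α hα) ∧
    (∃ f ∈ WallpaperAlg, piPlus α hα f ≠ piMinus α hα f) ∧
    IsMaxIdealIn WallpaperAlg {f ∈ WallpaperAlg | piPlus α hα f = 0} ∧
    IsMaxIdealIn WallpaperAlg {f ∈ WallpaperAlg | piMinus α hα f = 0} ∧
    {f ∈ WallpaperAlg | piPlus α hα f = 0} ≠ {f ∈ WallpaperAlg | piMinus α hα f = 0} ∧
    {f ∈ WallpaperAlg | piPlus α hα f = 0} ∩ centerIn WallpaperAlg =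
      {f ∈ centerIn WallpaperAlg | f (charPoint α hα) = 0} ∧
    {f ∈ WallpaperAlg | piMinus α hα f = 0} ∩ centerIn WallpaperAlg =
      {f ∈ centerIn WallpaperAlg | f (charPoint α hα) = 0} := by
  have hplus := WallpaperAlg.isCharacterOn_piPlus α hα
  have hminus : IsCharacterOn WallpaperAlg (piMinus α hα) :=
    WallpaperAlg.piMinus_eq_piPlus_neg α hα ▸ WallpaperAlg.isCharacterOn_piPlus _ _
  have hne := WallpaperAlg.ker_piPlus_ne_ker_piMinus α hα
  refine ⟨hplus, hminus, ?_, WallpaperAlg.isMaxIdealIn_ker hplus,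
    WallpaperAlg.isMaxIdealIn_ker hminus, hne, WallpaperAlg.ker_piPlus_inter_center α hα, ?_⟩
  · by_contra! h
    exact hne (Set.ext fun f ↦ and_congr_right fun hf ↦ by rw [h f hf])
  · rw [WallpaperAlg.piMinus_eq_piPlus_neg, WallpaperAlg.ker_piPlus_inter_center,
      WallpaperAlg.charPoint_neg]
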